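/- Let φ: S → R be a ring morphism, W ∈ S, and X a finite rank matrix factorisation of φ(W) over R with a fixed homogeneous R-basis. Let ((L,b),(M,b), σ, p, h) be a deformation retract datum of linear factorisations of zero over S, where (L,b) and (M,b) are linear factorisations of zero over R, p is R-linear, h² = 0, hσ = 0, ph = 0 (σ and h need only be S-linear). Extend h and σ across the chosen basis of X (with the Koszul sign for h) to S-linear maps 1⊗h, 1⊗σ on X⊗_R M resp. X⊗_R L → X⊗_R M. Suppose the perturbation d⊗1 is small, i.e. ((d⊗1)(1⊗h))^N = 0 on X⊗_R M for all sufficiently large N. Then ((X⊗_R L, d⊗1+1⊗b), (X⊗_R M, d⊗1+1⊗b), σ_∞, 1⊗p, h_∞), with σ_∞ = Σ_{m≥0}((1⊗h)(d⊗1))^m (1⊗σ) and h_∞ = Σ_{m≥0}((1⊗h)(d⊗1))^m (1⊗h), is a deformation retract datum of linear factorisations of W over S. -/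

import Mathlib

/-!
STATEMENT 2 (perturbing a deformation retract after tensoring with a finite rank
matrix factorisation).

Conventions.  ℤ/2-graded modules are encoded by a grading involution `g`; odd maps
anticommute with `g`, even maps commute, a linear factorisation of `W` is an odd `b`
with `b² = W·1`.  A finite rank matrix factorisation `X` of `φ(W)` over `R` with a fixed
homogeneous basis is encoded as `ι → R` with a parity function `par : ι → Bool`; its
grading involution is `gX par`, and the matrix of `d` is `dmat d`.  The tensor products
`X ⊗_R L ≅ ι → L` and `X ⊗_R M ≅ ι → M` carry the differentials `d⊗1 + 1⊗b`, where
`d⊗1` is the matrix extension `matExt (dmat d)`, and `1⊗b`, `1⊗h` carry the Koszul sign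
`(-1)^{|ξᵢ|}` (implemented through `par`), while `1⊗σ`, `1⊗p` are extended without
signs.  The grading of the tensor product is `gX ⊗ g`.  "Small" means `((d⊗1)(1⊗h))^N = 0`
for some (hence all larger) `N`; the infinite sums `σ_∞, h_∞` are then finite sums.
-/

namespace Stmt2

open LinearMap

variable {S R : Type*} [CommRing S] [CommRing R] [Algebra S R]
variable {ι : Type*} [Fintype ι] [DecidableEq ι]

/-- Grading involution of `ι → R` from the parities of the basis. -/
def gX (R : Type*) [CommRing R] {ι : Type*} [Fintype ι] [DecidableEq ι]
    (par : ι → Bool) : Module.End R (ι → R) :=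
  LinearMap.pi fun i => (if par i then (-1 : R) else 1) • LinearMap.proj i

/-- Matrix of an endomorphism of `ι → R`. -/
def dmat {R : Type*} [CommRing R] {ι : Type*} [Fintype ι] [DecidableEq ι]
    (d : Module.End R (ι → R)) (a b : ι) : R :=
  d (Pi.single b 1) a

/-- `d ⊗ 1` on `X ⊗_R M ≅ ι → M`: the extension of a matrix over `R` (no sign). -/
def matExt {R M : Type*} [CommRing R] [AddCommGroup M] [Module R M]
    {ι : Type*} [Fintype ι] [DecidableEq ι] (A : ι → ι → R) :
    (ι → M) →ₗ[R] (ι → M) :=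
  LinearMap.pi fun a => ∑ b, A a b • LinearMap.proj b

/-- `1 ⊗ t` for an even map `t` (no Koszul sign). -/
def evExt (S : Type*) [CommRing S] {L M : Type*} [AddCommGroup L] [Module S L]
    [AddCommGroup M] [Module S M] {ι : Type*} (t : L →ₗ[S] M) :
    (ι → L) →ₗ[S] (ι → M) :=
  LinearMap.pi fun i => t ∘ₗ LinearMap.proj i

/-- `1 ⊗ t` for an odd map `t`, with the Koszul sign `(-1)^{|ξᵢ|}`. -/
def oddExt (S : Type*) [CommRing S] {L M : Type*} [AddCommGroup L] [Module S L]
    [AddCommGroup M] [Module S M] {ι : Type*} (par : ι → Bool) (t : L →ₗ[S] M) :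
    (ι → L) →ₗ[S] (ι → M) :=
  LinearMap.pi fun i =>
    (if par i then (-1 : ℤ) else 1) • (t ∘ₗ LinearMap.proj i)

end Stmt2

namespace Stmt2

section Perturbation

variable {S L M : Type*} [CommRing S] [AddCommGroup L] [Module S L] [AddCommGroup M] [Module S M]

/-- A chain inclusion `i` and homotopy `h` with `i p = 1 + b h + h b`, perturbed by `μ` through an
inverse `T` of `1 - h μ`. -/
theorem perturbed_retract {W : S} {b μ h T : Module.End S M} {bL μL : Module.End S L}
    {p : M →ₗ[S] L} {i : L →ₗ[S] M}
    (hbμ : b * μ = -(μ * b)) (hμμ : μ * μ = W • 1)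
    (hTl : T * (1 - h * μ) = 1) (hTr : (1 - h * μ) * T = 1)
    (hpμ : p ∘ₗ μ = μL ∘ₗ p) (hbi : b ∘ₗ i = i ∘ₗ bL) (hpi : p ∘ₗ i = LinearMap.id)
    (hip : i ∘ₗ p = LinearMap.id + (b ∘ₗ h + h ∘ₗ b))
    (hhh : h * h = 0) (hhi : h ∘ₗ i = 0) (hph : p ∘ₗ h = 0) :
    (b + μ) ∘ₗ (T ∘ₗ i) = (T ∘ₗ i) ∘ₗ (μL + bL) ∧
    p ∘ₗ (T ∘ₗ i) = LinearMap.id ∧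
    (T ∘ₗ i) ∘ₗ p = LinearMap.id + ((b + μ) * (T * h) + (T * h) * (b + μ)) := by
  have bμ (x : M) : b (μ x) = -μ (b x) := LinearMap.congr_fun hbμ x
  have μμ (x : M) : μ (μ x) = W • x := LinearMap.congr_fun hμμ x
  have Tl (x : M) : T (x - h (μ x)) = x := LinearMap.congr_fun hTl x
  have Tr (x : M) : T x - h (μ (T x)) = x := LinearMap.congr_fun hTr x
  have pμ (x : M) : p (μ x) = μL (p x) := LinearMap.congr_fun hpμ x
  have bi (x : L) : b (i x) = i (bL x) := LinearMap.congr_fun hbi x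
  have pi (x : L) : p (i x) = x := LinearMap.congr_fun hpi x
  have ip (x : M) : i (p x) = x + (b (h x) + h (b x)) := LinearMap.congr_fun hip x
  have hh (x : M) : h (h x) = 0 := LinearMap.congr_fun hhh x
  have hi (x : L) : h (i x) = 0 := LinearMap.congr_fun hhi x
  have ph (x : M) : p (h x) = 0 := LinearMap.congr_fun hph x
  have pT (x : M) : p (T x) = p x := by
    conv_rhs => rw [← Tr x, map_sub, ph, sub_zero]
  have hT (x : M) : h (T x) = h x := by
    conv_rhs => rw [← Tr x, map_sub, hh, sub_zero]
  have key (x : M) : b (T x) + μ (T x) = T (b x + i (μL (p x)) - W • h x) := by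
    rw [← Tl (b (T x) + μ (T x))]
    congr 1
    have h1 := congrArg b (Tr x)
    have h2 := ip (μ (T x))
    rw [pμ, pT, bμ, map_neg] at h2
    rw [map_sub] at h1
    rw [h2, ← h1, map_add, map_add, μμ, map_smul, hT]
    abel
  refine ⟨?_, ?_, ?_⟩
  · ext x
    simp only [LinearMap.comp_apply, LinearMap.add_apply, key, bi, pi, hi, smul_zero, sub_zero,
      map_add]
    abel
  · ext x
    simp [pT, pi]
  · ext x
    simp only [LinearMap.comp_apply, LinearMap.add_apply, Module.End.mul_apply, key, ph, hh,
      smul_zero, sub_zero, map_zero, add_zero, LinearMap.id_apply, ip, map_add]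
    have h1 := Tl x
    rw [map_sub] at h1
    rw [← sub_eq_zero] at h1 ⊢
    rw [← h1]
    abel

end Perturbation

theorem geom_sum_inverse {A : Type*} [Ring A] {μ h : A} {N : ℕ} (hN : (μ * h) ^ N = 0) :
    (∑ m ∈ Finset.range (N + 1), (h * μ) ^ m) * (1 - h * μ) = 1 ∧
    (1 - h * μ) * ∑ m ∈ Finset.range (N + 1), (h * μ) ^ m = 1 := by
  have hz : (h * μ) ^ (N + 1) = 0 := by
    rw [pow_succ', mul_assoc, ← mul_pow_mul, hN]
    simp
  rw [geom_sum_mul_neg, mul_neg_geom_sum, hz, sub_zero]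
  exact ⟨rfl, rfl⟩

theorem commute_mul_of_anticommute {A : Type*} [Ring A] {g a b : A} (ha : a * g = -(g * a))
    (hb : b * g = -(g * b)) : Commute g (a * b) := by
  rw [commute_iff_eq, mul_assoc, hb, mul_neg, ← mul_assoc, ← mul_assoc, ha, neg_mul, neg_neg]

theorem anticommute_mul_of_commute {A : Type*} [Ring A] {g a t : A} (ht : Commute g t)
    (ha : a * g = -(g * a)) : t * a * g = -(g * (t * a)) := by
  rw [mul_assoc, ha, mul_neg, ← mul_assoc, ← mul_assoc, ht.eq]

section Extensions

variable {S R : Type*} [CommRing S] [CommRing R]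
variable {ι : Type*}
variable {K L M : Type*} [AddCommGroup K] [Module S K] [AddCommGroup L] [Module S L]
  [AddCommGroup M] [Module S M]

/-- The Koszul sign of a parity. -/
def koszulSign (ε : Bool) : ℤ := if ε then -1 else 1

theorem koszulSign_mul_self (ε : Bool) : koszulSign ε * koszulSign ε = 1 := by
  cases ε <;> rfl

theorem evExt_apply (t : L →ₗ[S] M) (x : ι → L) (i : ι) : evExt S t x i = t (x i) := rfl

theorem oddExt_apply (par : ι → Bool) (t : L →ₗ[S] M) (x : ι → L) (i : ι) :
    oddExt S par t x i = koszulSign (par i) • t (x i) := rfl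

theorem evExt_comp_evExt (s : L →ₗ[S] M) (t : K →ₗ[S] L) :
    (evExt S s : (ι → L) →ₗ[S] _) ∘ₗ evExt S t = evExt S (s ∘ₗ t) := rfl

theorem oddExt_comp_evExt (par : ι → Bool) (s : L →ₗ[S] M) (t : K →ₗ[S] L) :
    oddExt S par s ∘ₗ evExt S t = oddExt S par (s ∘ₗ t) := rfl

theorem evExt_comp_oddExt (par : ι → Bool) (s : L →ₗ[S] M) (t : K →ₗ[S] L) :
    evExt S s ∘ₗ oddExt S par t = oddExt S par (s ∘ₗ t) := by
  refine LinearMap.ext fun x => funext fun i => ?_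
  simp only [LinearMap.comp_apply, evExt_apply, oddExt_apply, map_zsmul]

theorem oddExt_comp_oddExt (par : ι → Bool) (s : L →ₗ[S] M) (t : K →ₗ[S] L) :
    oddExt S par s ∘ₗ oddExt S par t = evExt S (s ∘ₗ t) := by
  refine LinearMap.ext fun x => funext fun i => ?_
  simp only [LinearMap.comp_apply, evExt_apply, oddExt_apply, map_zsmul, smul_smul,
    koszulSign_mul_self, one_smul]

theorem evExt_neg (t : L →ₗ[S] M) : (evExt S (-t) : (ι → L) →ₗ[S] _) = -evExt S t := rfl

theorem evExt_zero : (evExt S (0 : L →ₗ[S] M) : (ι → L) →ₗ[S] _) = 0 := rfl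

theorem oddExt_zero (par : ι → Bool) : oddExt S par (0 : L →ₗ[S] M) = 0 :=
  LinearMap.ext fun _ => funext fun i => smul_zero (koszulSign (par i))

variable [Fintype ι] [DecidableEq ι]
variable [Module R L] [Module R M]

theorem matExt_apply (A : ι → ι → R) (x : ι → M) (a : ι) :
    matExt A x a = ∑ c, A a c • x c := by
  simp [matExt]

theorem matExt_comp_evExt (A : ι → ι → R) (t : L →ₗ[R] M) :
    matExt A ∘ₗ evExt R t = evExt R t ∘ₗ matExt A := by
  refine LinearMap.ext fun x => funext fun a => ?_
  simp only [LinearMap.comp_apply, evExt_apply, matExt_apply, map_sum, map_smul]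

variable {par : ι → Bool} {d : Module.End R (ι → R)}

theorem koszulSign_smul_dmat (hd : d * gX R par = -(gX R par * d)) (a c : ι) :
    koszulSign (par c) • dmat d a c = -(koszulSign (par a) • dmat d a c) := by
  have hg (x : ι → R) (i : ι) : gX R par x i = koszulSign (par i) • x i := by
    cases hi : par i <;> simp [gX, koszulSign, hi]
  have hs : gX R par (Pi.single c 1) = koszulSign (par c) • Pi.single c (1 : R) := by
    ext i
    rw [hg, Pi.smul_apply]
    by_cases hi : i = c
    · rw [hi]
    · simp [hi]
  have := congrFun (LinearMap.congr_fun hd (Pi.single c 1)) a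
  rwa [Module.End.mul_apply, hs, map_zsmul, LinearMap.neg_apply, Module.End.mul_apply,
    Pi.neg_apply, hg] at this

/-- `d ⊗ 1` anticommutes with every signed extension, `d` being odd. -/
theorem matExt_comp_oddExt (hd : d * gX R par = -(gX R par * d)) (t : L →ₗ[R] M) :
    matExt (dmat d) ∘ₗ oddExt R par t = -(oddExt R par t ∘ₗ matExt (dmat d)) := by
  refine LinearMap.ext fun x => funext fun a => ?_
  simp only [LinearMap.comp_apply, LinearMap.neg_apply, Pi.neg_apply, oddExt_apply, matExt_apply,
    map_sum, map_smul, Finset.smul_sum, ← Finset.sum_neg_distrib]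
  refine Finset.sum_congr rfl fun c _ => ?_
  rw [smul_comm, ← smul_assoc, koszulSign_smul_dmat hd, neg_smul, smul_assoc]

theorem matExt_mul_self {w : R} (hd : d * d = w • (1 : Module.End R (ι → R))) :
    (matExt (dmat d) : Module.End R (ι → M)) * matExt (dmat d) = w • 1 := by
  have hm (a c : ι) : ∑ e, dmat d a e * dmat d e c = if a = c then w else 0 := by
    have h1 := congrArg LinearMap.toMatrix' hd
    rw [LinearMap.toMatrix'_mul] at h1
    have h2 := congrFun (congrFun h1 a) c
    simpa [Matrix.mul_apply, LinearMap.toMatrix'_apply, dmat, Matrix.one_apply,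
      Pi.single_apply] using h2
  refine LinearMap.ext fun x => funext fun a => ?_
  simp only [Module.End.mul_apply, matExt_apply, Finset.smul_sum, smul_smul]
  rw [Finset.sum_comm]
  simp only [← Finset.sum_smul, hm]
  simp

theorem factorisation_odd (hd : d * gX R par = -(gX R par * d)) {b g : Module.End R M}
    (hb : b * g = -(g * b)) :
    (matExt (dmat d) + oddExt R par b) * oddExt R par g =
      -(oddExt R par g * (matExt (dmat d) + oddExt R par b)) := by
  rw [add_mul, mul_add, neg_add]
  congr 1
  · exact matExt_comp_oddExt hd g
  · simp only [Module.End.mul_eq_comp] at hb ⊢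
    rw [oddExt_comp_oddExt, oddExt_comp_oddExt, hb, evExt_neg]

theorem factorisation_sq (hd : d * gX R par = -(gX R par * d)) {w : R}
    (hdd : d * d = w • (1 : Module.End R (ι → R))) {b : Module.End R M} (hb : b * b = 0) :
    (matExt (dmat d) + oddExt R par b) * (matExt (dmat d) + oddExt R par b) = w • 1 := by
  have h1 : oddExt R par b * oddExt R par b = 0 := by
    rw [Module.End.mul_eq_comp] at hb ⊢
    rw [oddExt_comp_oddExt, hb, evExt_zero]
  have h2 : matExt (dmat d) * oddExt R par b = -(oddExt R par b * matExt (dmat d)) :=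
    matExt_comp_oddExt hd b
  rw [add_mul, mul_add, mul_add, h1, h2, matExt_mul_self hdd]
  abel

end Extensions

end Stmt2

open Stmt2 in
theorem statement2
    {S R : Type*} [CommRing S] [CommRing R] [Algebra S R] (W : S)
    -- X: finite rank matrix factorisation of φ(W) over R with homogeneous basis
    {ι : Type*} [Fintype ι] [DecidableEq ι] (par : ι → Bool)
    (d : Module.End R (ι → R))
    (hd_odd : d * gX R par = -(gX R par * d))
    (hd_sq : d * d = algebraMap S R W • (1 : Module.End R (ι → R)))
    -- (L, bL), (M, bM): linear factorisations of zero over R …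
    {L M : Type*} [AddCommGroup L] [Module R L] [Module S L] [IsScalarTower S R L]
    [AddCommGroup M] [Module R M] [Module S M] [IsScalarTower S R M]
    (gL : Module.End R L) (gM : Module.End R M)
    (hgL : gL * gL = 1) (hgM : gM * gM = 1)
    (bL : Module.End R L) (bM : Module.End R M)
    (hbL_odd : bL * gL = -(gL * bL)) (hbM_odd : bM * gM = -(gM * bM))
    (hbL_sq : bL * bL = 0) (hbM_sq : bM * bM = 0)
    -- … a deformation retract datum over S, with p R-linear and σ, h only S-linear
    (p : M →ₗ[R] L) (σ : L →ₗ[S] M) (h : M →ₗ[S] M)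
    (hp_even : gL ∘ₗ p = p ∘ₗ gM) (hp_chain : bL ∘ₗ p = p ∘ₗ bM)
    (hσ_even : gM.restrictScalars S ∘ₗ σ = σ ∘ₗ gL.restrictScalars S)
    (hσ_chain : bM.restrictScalars S ∘ₗ σ = σ ∘ₗ bL.restrictScalars S)
    (hh_odd : h ∘ₗ gM.restrictScalars S = -(gM.restrictScalars S ∘ₗ h))
    (hpσ : p.restrictScalars S ∘ₗ σ = LinearMap.id)
    (hσp : σ ∘ₗ p.restrictScalars S =
      LinearMap.id + (bM.restrictScalars S ∘ₗ h + h ∘ₗ bM.restrictScalars S))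
    -- side conditions
    (hh2 : h ∘ₗ h = 0) (hhσ : h ∘ₗ σ = 0) (hph : p.restrictScalars S ∘ₗ h = 0)
    -- smallness of the perturbation d ⊗ 1
    (N : ℕ)
    (hsmall :
      (((matExt (dmat d) : Module.End R (ι → M)).restrictScalars S) *
        oddExt S par h) ^ N = 0) :
    -- notation for the data of the perturbed deformation retract
    let DM : Module.End R (ι → M) := matExt (dmat d) + oddExt R par (bM : M →ₗ[R] M)
    let DL : Module.End R (ι → L) := matExt (dmat d) + oddExt R par (bL : L →ₗ[R] L)
    let GrM : Module.End R (ι → M) := oddExt R par (gM : M →ₗ[R] M)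
    let GrL : Module.End R (ι → L) := oddExt R par (gL : L →ₗ[R] L)
    let σinf : (ι → L) →ₗ[S] (ι → M) :=
      ∑ m ∈ Finset.range (N + 1),
        ((oddExt S par h *
          ((matExt (dmat d) : Module.End R (ι → M)).restrictScalars S)) ^ m) ∘ₗ
          evExt S (σ : L →ₗ[S] M)
    let hinf : Module.End S (ι → M) :=
      ∑ m ∈ Finset.range (N + 1),
        ((oddExt S par h *
          ((matExt (dmat d) : Module.End R (ι → M)).restrictScalars S)) ^ m) *
          oddExt S par h
    -- (X⊗L, d⊗1 + 1⊗bL) and (X⊗M, d⊗1 + 1⊗bM) are linear factorisations of W: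
    (DL * GrL = -(GrL * DL)) ∧
    (DL * DL = algebraMap S R W • (1 : Module.End R (ι → L))) ∧
    (DM * GrM = -(GrM * DM)) ∧
    (DM * DM = algebraMap S R W • (1 : Module.End R (ι → M))) ∧
    -- 1⊗p is a morphism of linear factorisations over R:
    (GrL ∘ₗ (evExt R (p : M →ₗ[R] L)) = (evExt R (p : M →ₗ[R] L)) ∘ₗ GrM) ∧
    (DL ∘ₗ (evExt R (p : M →ₗ[R] L)) = (evExt R (p : M →ₗ[R] L)) ∘ₗ DM) ∧
    -- σ∞ is a morphism of linear factorisations over S: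
    (GrM.restrictScalars S ∘ₗ σinf = σinf ∘ₗ GrL.restrictScalars S) ∧
    (DM.restrictScalars S ∘ₗ σinf = σinf ∘ₗ DL.restrictScalars S) ∧
    -- h∞ is a degree one map:
    (hinf * GrM.restrictScalars S = -(GrM.restrictScalars S * hinf)) ∧
    -- deformation retract identities over S:
    ((evExt R (p : M →ₗ[R] L)).restrictScalars S ∘ₗ σinf = LinearMap.id) ∧
    (σinf ∘ₗ (evExt R (p : M →ₗ[R] L)).restrictScalars S =
      LinearMap.id +
        (DM.restrictScalars S * hinf + hinf * DM.restrictScalars S)) := by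
  intro DM DL GrM GrL σinf hinf
  have hGp : GrL ∘ₗ evExt R p = evExt R p ∘ₗ GrM := by
    rw [oddExt_comp_evExt, evExt_comp_oddExt, hp_even]
  have hDp : DL ∘ₗ evExt R p = evExt R p ∘ₗ DM := by
    rw [LinearMap.add_comp, LinearMap.comp_add, matExt_comp_evExt, oddExt_comp_evExt,
      evExt_comp_oddExt, hp_chain]
  let μ : Module.End S (ι → M) := (matExt (dmat d) : Module.End R (ι → M)).restrictScalars S
  let H : Module.End S (ι → M) := oddExt S par h
  let B : Module.End S (ι → M) := oddExt S par (bM.restrictScalars S)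
  let G : Module.End S (ι → M) := oddExt S par (gM.restrictScalars S)
  let T : Module.End S (ι → M) := ∑ m ∈ Finset.range (N + 1), (H * μ) ^ m
  have hσinf : σinf = T ∘ₗ evExt S σ :=
    (map_sum (LinearMap.lcomp S (ι → M) (evExt S σ : (ι → L) →ₗ[S] _)) _ _).symm
  have hhinf : hinf = T * H := (Finset.sum_mul _ _ _).symm
  have hDM : DM.restrictScalars S = B + μ := add_comm μ B
  obtain ⟨hTl, hTr⟩ := geom_sum_inverse (μ := μ) (h := H) hsmall
  have hGμ : μ * G = -(G * μ) :=
    LinearMap.ext fun x => LinearMap.congr_fun (matExt_comp_oddExt hd_odd gM) x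
  have hGH : H * G = -(G * H) := by
    change oddExt S par h ∘ₗ oddExt S par _ = -(oddExt S par _ ∘ₗ oddExt S par h)
    rw [oddExt_comp_oddExt, oddExt_comp_oddExt, hh_odd, evExt_neg]
  have hGT : Commute G T :=
    Commute.sum_right _ _ _ fun m _ => (commute_mul_of_anticommute hGH hGμ).pow_right m
  obtain ⟨h1, h2, h3⟩ := perturbed_retract (W := W) (b := B) (μ := μ) (h := H) (T := T)
    (bL := oddExt S par (bL.restrictScalars S))
    (μL := (matExt (dmat d) : Module.End R (ι → L)).restrictScalars S)
    (p := evExt S (p.restrictScalars S)) (i := evExt S σ)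
    (LinearMap.ext fun x => eq_neg_of_add_eq_zero_right <| add_eq_zero_iff_eq_neg.mpr <|
      LinearMap.congr_fun (matExt_comp_oddExt hd_odd bM) x)
    (LinearMap.ext fun x => (LinearMap.congr_fun (matExt_mul_self hd_sq) x).trans
      (algebraMap_smul R W x)) hTl hTr
    (LinearMap.ext fun x => (LinearMap.congr_fun (matExt_comp_evExt (dmat d) p) x).symm)
    (by rw [oddExt_comp_evExt, evExt_comp_oddExt, hσ_chain])
    (by rw [evExt_comp_evExt, hpσ]; rfl)
    (by rw [evExt_comp_evExt, hσp, oddExt_comp_oddExt, oddExt_comp_oddExt]; rfl)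
    (by rw [Module.End.mul_eq_comp, oddExt_comp_oddExt, hh2, evExt_zero])
    (by rw [oddExt_comp_evExt, hhσ, oddExt_zero])
    (by rw [evExt_comp_oddExt, hph, oddExt_zero])
  refine ⟨factorisation_odd hd_odd hbL_odd, factorisation_sq hd_odd hd_sq hbL_sq,
    factorisation_odd hd_odd hbM_odd, factorisation_sq hd_odd hd_sq hbM_sq, hGp, hDp, ?_, ?_, ?_,
    ?_, ?_⟩
  · rw [hσinf]
    change (G * T) ∘ₗ evExt S σ = T ∘ₗ (evExt S σ ∘ₗ oddExt S par (gL.restrictScalars S))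
    rw [hGT.eq, evExt_comp_oddExt, ← hσ_even, ← oddExt_comp_evExt]
    rfl
  · rw [hσinf, hDM]
    exact h1
  · rw [hhinf]
    exact anticommute_mul_of_commute hGT hGH
  · rw [hσinf]
    exact h2
  · rw [hσinf, hhinf, hDM]
    exact h3
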